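/- arXiv:2011.09365 — 3 statements merged into one kernel-verified Lean document; each statement's English description precedes it below -/
import Mathlib

section
/- Let X₁, …, Xₙ be independent with regular cdfs F₁, …, Fₙ (densities fᵢ, finite expectations, increasing virtual values ψᵢ) and let rᵢ = ψᵢ⁻¹(0) be the monopoly prices. Then the expected revenue of the eager second-price auction with reserve prices (r₁, …, rₙ) is at least the expected revenue of the lazy second-price auction with the same reserve prices. A key step is that regularity of Fᵢ implies x ↦ x(1 − Fᵢ(x)) is nonincreasing for x ≥ rᵢ. -/
open MeasureTheory Set

/-- The probability measure of a bidder whose value has density `f` on `[0,∞)`. -/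
noncomputable def valueMeasure (f : ℝ → ℝ) : Measure ℝ :=
  (volume.restrict (Ici 0)).withDensity fun x => ENNReal.ofReal (f x)

theorem key_antitone (F f ψ : ℝ → ℝ) (hc : Continuous f) (hp : ∀ x, 0 ≤ x → 0 < f x)
    (hF : ∀ x, F x = ∫ t in (0:ℝ)..x, f t) (hψ : ∀ x, ψ x = x - (1 - F x) / f x)
    (hreg : StrictMonoOn ψ (Ici 0)) (r : ℝ) (hr : 0 ≤ r) (hr0 : ψ r = 0) :
    AntitoneOn (fun x => x * (1 - F x)) (Ici r) := by
  have hd : ∀ x, HasDerivAt F (f x) x := by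
    intro x
    have : F = fun x => ∫ t in (0:ℝ)..x, f t := funext hF
    rw [this]
    exact intervalIntegral.integral_hasDerivAt_right (hc.intervalIntegrable _ _)
      hc.aestronglyMeasurable.stronglyMeasurableAtFilter hc.continuousAt
  have hd2 : ∀ x, HasDerivAt (fun x => x * (1 - F x)) (1 * (1 - F x) + x * (0 - f x)) x := fun x =>
    (hasDerivAt_id x).mul ((hasDerivAt_const x (1:ℝ)).sub (hd x))
  apply antitoneOn_of_deriv_nonpos (convex_Ici r)
  · exact fun x _ => (hd2 x).continuousAt.continuousWithinAt
  · exact fun x _ => (hd2 x).differentiableAt.differentiableWithinAt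
  · intro x hx
    rw [interior_Ici] at hx
    rw [(hd2 x).deriv]
    have hx' : r < x := hx
    have h0 : 0 ≤ x := hr.trans hx'.le
    have h1 := hreg (mem_Ici.2 hr) (mem_Ici.2 h0) hx'
    rw [hr0, hψ] at h1
    have h2 := hp x h0
    have h3 : (1 - F x) / f x < x := by linarith
    rw [div_lt_iff₀ h2] at h3
    linarith

theorem tail_measure (F f : ℝ → ℝ) (hc : Continuous f) (hp : ∀ x, 0 ≤ x → 0 < f x)
    (hF : ∀ x, F x = ∫ t in (0:ℝ)..x, f t) (hprob : IsProbabilityMeasure (valueMeasure f))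
    (t : ℝ) (ht : 0 ≤ t) :
    valueMeasure f (Ioi t) = ENNReal.ofReal (1 - F t) := by
  have h1 : valueMeasure f (Iic t) = ENNReal.ofReal (F t) := by
    rw [valueMeasure, withDensity_apply _ measurableSet_Iic, Measure.restrict_restrict
      measurableSet_Iic, hF, intervalIntegral.integral_of_le ht, ← integral_Icc_eq_integral_Ioc,
      inter_comm, Ici_inter_Iic]
    rw [ofReal_integral_eq_lintegral_ofReal]
    · exact (hc.integrableOn_Icc)
    · filter_upwards [ae_restrict_mem measurableSet_Icc] with x hx using (hp x hx.1).le
  have h0 : 0 ≤ F t := by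
    rw [hF]
    exact intervalIntegral.integral_nonneg ht fun x hx => (hp x hx.1).le
  rw [← compl_Iic, prob_compl_eq_one_sub measurableSet_Iic, h1, ENNReal.ofReal_sub _ h0,
    ENNReal.ofReal_one]

theorem tail_measure_Ici (f : ℝ → ℝ) (t : ℝ) : valueMeasure f (Ici t) = valueMeasure f (Ioi t) := by
  have h : valueMeasure f {t} = 0 := by
    apply withDensity_absolutelyContinuous
    simp
  apply le_antisymm
  · rw [← Ioi_insert, insert_eq]
    refine (measure_union_le _ _).trans ?_
    rw [h, zero_add]
  · exact measure_mono Ioi_subset_Ici_self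

/-- Threshold of bidder `i` in the lazy auction. -/
noncomputable def thL {n : ℕ} [NeZero n] (r : Fin n → ℝ) (i : Fin n) (x : Fin n → ℝ) : ℝ :=
  Finset.univ.sup' Finset.univ_nonempty fun j => if j = i then r i else x j

/-- Threshold of bidder `i` in the eager auction. -/
noncomputable def thE {n : ℕ} [NeZero n] (r : Fin n → ℝ) (i : Fin n) (x : Fin n → ℝ) : ℝ :=
  Finset.univ.sup' Finset.univ_nonempty fun j =>
    if j = i then r i else if r j ≤ x j then x j else 0

section
variable {n : ℕ} [NeZero n] (r : Fin n → ℝ)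

theorem le_thL (i : Fin n) (x : Fin n → ℝ) (j : Fin n) :
    (if j = i then r i else x j) ≤ thL r i x :=
  Finset.le_sup' (fun j => if j = i then r i else x j) (Finset.mem_univ j)

theorem le_thE (i : Fin n) (x : Fin n → ℝ) (j : Fin n) :
    (if j = i then r i else if r j ≤ x j then x j else 0) ≤ thE r i x :=
  Finset.le_sup' (fun j => if j = i then r i else if r j ≤ x j then x j else 0) (Finset.mem_univ j)

theorem r_le_thL (i : Fin n) (x : Fin n → ℝ) : r i ≤ thL r i x := by
  simpa using le_thL r i x i

theorem r_le_thE (i : Fin n) (x : Fin n → ℝ) : r i ≤ thE r i x := by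
  simpa using le_thE r i x i

theorem thE_le_thL (hr : ∀ i, 0 ≤ r i) (i : Fin n) (x : Fin n → ℝ) : thE r i x ≤ thL r i x := by
  apply Finset.sup'_le
  intro j _
  have h1 := le_thL r i x j
  have h2 := r_le_thL r i x
  have h3 := hr i
  split_ifs at * <;> linarith

theorem thL_update (i : Fin n) (x : Fin n → ℝ) (y : ℝ) :
    thL r i (Function.update x i y) = thL r i x := by
  unfold thL
  congr 1
  funext j
  by_cases h : j = i <;> simp [h]

theorem thE_update (i : Fin n) (x : Fin n → ℝ) (y : ℝ) :
    thE r i (Function.update x i y) = thE r i x := by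
  unfold thE
  congr 1
  funext j
  by_cases h : j = i <;> simp [h]

theorem thL_le (hr : ∀ i, 0 ≤ r i) (i : Fin n) (x : Fin n → ℝ) :
    thL r i x ≤ ∑ j, (r j + |x j|) := by
  apply Finset.sup'_le
  intro j _
  have h0 : ∀ j ∈ Finset.univ, 0 ≤ r j + |x j| := fun j _ => add_nonneg (hr j) (abs_nonneg _)
  have h1 := Finset.single_le_sum h0 (Finset.mem_univ i)
  have h2 := Finset.single_le_sum h0 (Finset.mem_univ j)
  have := le_abs_self (x j)
  have := abs_nonneg (x i)
  have := hr j
  split_ifs <;> linarith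

theorem measurable_thL (i : Fin n) : Measurable (thL r i) := by
  have : thL r i = Finset.univ.sup' Finset.univ_nonempty
      fun j => fun x : Fin n → ℝ => if j = i then r i else x j := by
    funext x; simp [thL, Finset.sup'_apply]
  rw [this]
  apply Finset.measurable_sup'
  intro j _
  by_cases h : j = i <;> simp only [h, if_true, if_false] <;> fun_prop

theorem measurable_thE (i : Fin n) : Measurable (thE r i) := by
  have : thE r i = Finset.univ.sup' Finset.univ_nonempty
      fun j => fun x : Fin n → ℝ => if j = i then r i else if r j ≤ x j then x j else 0 := by
    funext x; simp [thE, Finset.sup'_apply]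
  rw [this]
  apply Finset.measurable_sup'
  intro j _
  by_cases h : j = i
  · simp only [h, if_true]; fun_prop
  · simp only [h, if_false]
    exact Measurable.ite (measurableSet_le measurable_const (measurable_pi_apply j))
      (measurable_pi_apply j) measurable_const

/-- Lazy payment of bidder `i`. -/
noncomputable def payL (i : Fin n) (x : Fin n → ℝ) : ℝ := if thL r i x ≤ x i then thL r i x else 0
/-- Eager payment of bidder `i`. -/
noncomputable def payE (i : Fin n) (x : Fin n → ℝ) : ℝ := if thE r i x < x i then thE r i x else 0

theorem measurable_payL (i : Fin n) : Measurable (payL r i) :=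
  Measurable.ite (measurableSet_le (measurable_thL r i) (measurable_pi_apply i))
    (measurable_thL r i) measurable_const

theorem measurable_payE (i : Fin n) : Measurable (payE r i) :=
  Measurable.ite (measurableSet_lt (measurable_thE r i) (measurable_pi_apply i))
    (measurable_thE r i) measurable_const

theorem payL_nonneg (hr : ∀ i, 0 ≤ r i) (i : Fin n) (x : Fin n → ℝ) : 0 ≤ payL r i x := by
  unfold payL
  have := r_le_thL r i x
  have := hr i
  split_ifs <;> linarith

theorem payE_nonneg (hr : ∀ i, 0 ≤ r i) (i : Fin n) (x : Fin n → ℝ) : 0 ≤ payE r i x := by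
  unfold payE
  have := r_le_thE r i x
  have := hr i
  split_ifs <;> linarith

theorem pay_le (hr : ∀ i, 0 ≤ r i) (i : Fin n) (x : Fin n → ℝ) :
    payL r i x ≤ ∑ j, (r j + |x j|) ∧ payE r i x ≤ ∑ j, (r j + |x j|) := by
  have h0 : 0 ≤ ∑ j, (r j + |x j|) :=
    Finset.sum_nonneg fun j _ => add_nonneg (hr j) (abs_nonneg _)
  have h1 := thL_le r hr i x
  have h2 := thE_le_thL r hr i x
  unfold payL payE
  constructor <;> split_ifs <;> linarith

theorem lintegral_pay (hr : ∀ i, 0 ≤ r i) (F f : Fin n → ℝ → ℝ)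
    (hc : ∀ i, Continuous (f i)) (hp : ∀ i x, 0 ≤ x → 0 < f i x)
    (hF : ∀ i x, F i x = ∫ t in (0:ℝ)..x, f i t)
    (hanti : ∀ i, AntitoneOn (fun x => x * (1 - F i x)) (Ici (r i)))
    (μ : Fin n → Measure ℝ) (hμ : ∀ i, μ i = valueMeasure (f i))
    (hprob : ∀ i, IsProbabilityMeasure (μ i)) (i : Fin n) :
    ∫⁻ x, ENNReal.ofReal (payL r i x) ∂Measure.pi μ
      ≤ ∫⁻ x, ENNReal.ofReal (payE r i x) ∂Measure.pi μ := by
  have mL : Measurable fun x => ENNReal.ofReal (payL r i x) := (measurable_payL r i).ennreal_ofReal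
  have mE : Measurable fun x => ENNReal.ofReal (payE r i x) := (measurable_payE r i).ennreal_ofReal
  rw [lintegral_eq_lmarginal_univ (0 : Fin n → ℝ), lintegral_eq_lmarginal_univ (0 : Fin n → ℝ),
    lmarginal_erase' _ mL (Finset.mem_univ i), lmarginal_erase' _ mE (Finset.mem_univ i)]
  refine lmarginal_mono (fun x => ?_) _
  have tm : ∀ t, 0 ≤ t → μ i (Ioi t) = ENNReal.ofReal (1 - F i t) := by
    intro t ht
    have := hprob i
    rw [hμ] at this ⊢
    exact tail_measure (F i) (f i) (hc i) (hp i) (hF i) this t ht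
  have hLr := r_le_thL r i x
  have hEr := r_le_thE r i x
  have hL0 := (hr i).trans hLr
  have hE0 := (hr i).trans hEr
  have eL : ∀ y, ENNReal.ofReal (payL r i (Function.update x i y))
      = (Ici (thL r i x)).indicator (fun _ => ENNReal.ofReal (thL r i x)) y := by
    intro y
    simp only [payL, thL_update, Function.update_self, indicator, mem_Ici]
    split_ifs <;> simp
  have eE : ∀ y, ENNReal.ofReal (payE r i (Function.update x i y))
      = (Ioi (thE r i x)).indicator (fun _ => ENNReal.ofReal (thE r i x)) y := by
    intro y
    simp only [payE, thE_update, Function.update_self, indicator, mem_Ioi]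
    split_ifs <;> simp
  simp only [eL, eE]
  rw [lintegral_indicator_const measurableSet_Ici, lintegral_indicator_const measurableSet_Ioi]
  have : μ i (Ici (thL r i x)) = μ i (Ioi (thL r i x)) := by
    rw [hμ]; exact tail_measure_Ici _ _
  rw [this, tm _ hL0, tm _ hE0, ← ENNReal.ofReal_mul hL0, ← ENNReal.ofReal_mul hE0]
  exact ENNReal.ofReal_le_ofReal (hanti i hEr hLr (thE_le_thL r hr i x))

theorem integrable_bound (μ : Fin n → Measure ℝ) (hprob : ∀ i, IsProbabilityMeasure (μ i))
    (hexp : ∀ i, Integrable (fun x => x) (μ i)) :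
    Integrable (fun x : Fin n → ℝ => ∑ j, (r j + |x j|)) (Measure.pi μ) := by
  apply integrable_finsetSum
  intro j _
  apply (integrable_const _).add
  exact (integrable_comp_eval (μ := μ) (i := j) (hexp j)).abs

theorem integral_pay (hr : ∀ i, 0 ≤ r i) (F f : Fin n → ℝ → ℝ)
    (hc : ∀ i, Continuous (f i)) (hp : ∀ i x, 0 ≤ x → 0 < f i x)
    (hF : ∀ i x, F i x = ∫ t in (0:ℝ)..x, f i t)
    (hanti : ∀ i, AntitoneOn (fun x => x * (1 - F i x)) (Ici (r i)))
    (μ : Fin n → Measure ℝ) (hμ : ∀ i, μ i = valueMeasure (f i))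
    (hprob : ∀ i, IsProbabilityMeasure (μ i))
    (hexp : ∀ i, Integrable (fun x => x) (μ i)) (i : Fin n) :
    Integrable (payL r i) (Measure.pi μ) ∧ Integrable (payE r i) (Measure.pi μ) ∧
    ∫ x, payL r i x ∂Measure.pi μ ≤ ∫ x, payE r i x ∂Measure.pi μ := by
  have hB := integrable_bound r μ hprob hexp
  have iL : Integrable (payL r i) (Measure.pi μ) := by
    refine hB.mono' (measurable_payL r i).aestronglyMeasurable (Filter.Eventually.of_forall ?_)
    intro x
    rw [Real.norm_of_nonneg (payL_nonneg r hr i x)]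
    exact (pay_le r hr i x).1
  have iE : Integrable (payE r i) (Measure.pi μ) := by
    refine hB.mono' (measurable_payE r i).aestronglyMeasurable (Filter.Eventually.of_forall ?_)
    intro x
    rw [Real.norm_of_nonneg (payE_nonneg r hr i x)]
    exact (pay_le r hr i x).2
  refine ⟨iL, iE, ?_⟩
  rw [← ENNReal.ofReal_le_ofReal_iff (integral_nonneg (payE_nonneg r hr i)),
    ofReal_integral_eq_lintegral_ofReal iL (Filter.Eventually.of_forall (payL_nonneg r hr i)),
    ofReal_integral_eq_lintegral_ofReal iE (Filter.Eventually.of_forall (payE_nonneg r hr i))]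
  exact lintegral_pay r hr F f hc hp hF hanti μ hμ hprob i

/-- Eager revenue as a supremum over all bidders. -/
noncomputable def revE (we : (Fin n → ℝ) → Fin n) (x : Fin n → ℝ) : ℝ :=
  Finset.univ.sup' Finset.univ_nonempty fun j =>
    if r j ≤ x j then (if j = we x then r j else x j) else 0

theorem le_revE (we : (Fin n → ℝ) → Fin n) (x : Fin n → ℝ) (j : Fin n) :
    (if r j ≤ x j then (if j = we x then r j else x j) else 0) ≤ revE r we x :=
  Finset.le_sup' (fun j => if r j ≤ x j then (if j = we x then r j else x j) else 0)
    (Finset.mem_univ j)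

theorem revE_eq (hr : ∀ i, 0 ≤ r i) (we : (Fin n → ℝ) → Fin n) (x : Fin n → ℝ) :
    (if hS : (Finset.univ.filter fun j => r j ≤ x j).Nonempty then
      (Finset.univ.filter fun j => r j ≤ x j).sup' hS
        fun j => if j = we x then r (we x) else x j
      else 0) = revE r we x := by
  split_ifs with hS
  · apply le_antisymm
    · apply Finset.sup'_le
      intro j hj
      have hj' : r j ≤ x j := by simpa using hj
      have := le_revE r we x j
      rw [if_pos hj'] at this
      refine le_trans (le_of_eq ?_) this
      by_cases h : j = we x
      · rw [if_pos h, if_pos h, ← h]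
      · rw [if_neg h, if_neg h]
    · apply Finset.sup'_le
      intro j _
      have key : ∀ k, r k ≤ x k → (if k = we x then r k else x k) ≤
          (Finset.univ.filter fun j => r j ≤ x j).sup' hS
            fun j => if j = we x then r (we x) else x j := by
        intro k hk
        have := Finset.le_sup' (s := Finset.univ.filter fun j => r j ≤ x j)
          (fun j => if j = we x then r (we x) else x j) (b := k) (by simpa using hk)
        refine le_trans (le_of_eq ?_) this
        by_cases h : k = we x
        · simp only [if_pos h]; rw [← h]
        · simp only [if_neg h]
      by_cases hj : r j ≤ x j
      · rw [if_pos hj]; exact key j hj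
      · rw [if_neg hj]
        obtain ⟨k, hk⟩ := hS
        have hk' : r k ≤ x k := by simpa using hk
        refine le_trans ?_ (key k hk')
        have := hr k
        split_ifs <;> linarith
  · have h : ∀ j, ¬ r j ≤ x j := by
      intro j hj
      exact hS ⟨j, by simpa using hj⟩
    unfold revE
    simp only [if_neg (h _)]
    simp

theorem revE_nonneg (hr : ∀ i, 0 ≤ r i) (we : (Fin n → ℝ) → Fin n) (x : Fin n → ℝ) :
    0 ≤ revE r we x := by
  have h1 := le_revE r we x 0
  have := hr 0
  split_ifs at h1 <;> linarith

theorem revE_le (hr : ∀ i, 0 ≤ r i) (we : (Fin n → ℝ) → Fin n) (x : Fin n → ℝ) :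
    revE r we x ≤ ∑ j, (r j + |x j|) := by
  apply Finset.sup'_le
  intro j _
  have h0 : ∀ j ∈ Finset.univ, 0 ≤ r j + |x j| := fun j _ => add_nonneg (hr j) (abs_nonneg _)
  have h2 := Finset.single_le_sum h0 (Finset.mem_univ j)
  have := le_abs_self (x j)
  have := abs_nonneg (x j)
  have := hr j
  split_ifs <;> linarith

theorem measurable_revE (we : (Fin n → ℝ) → Fin n)
    (hwe_meas : ∀ i, MeasurableSet {x : Fin n → ℝ | we x = i}) : Measurable (revE r we) := by
  have : revE r we = Finset.univ.sup' Finset.univ_nonempty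
      fun j => fun x : Fin n → ℝ => if r j ≤ x j then (if j = we x then r j else x j) else 0 := by
    funext x; simp [revE, Finset.sup'_apply]
  rw [this]
  apply Finset.measurable_sup'
  intro j _
  refine Measurable.ite (measurableSet_le measurable_const (measurable_pi_apply j)) ?_
    measurable_const
  refine Measurable.ite ?_ measurable_const (measurable_pi_apply j)
  simpa [eq_comm] using hwe_meas j

theorem sum_payE_le (hr : ∀ i, 0 ≤ r i) (we : (Fin n → ℝ) → Fin n) (x : Fin n → ℝ)
    (hwe : (Finset.univ.filter fun j => r j ≤ x j).Nonempty →
      we x ∈ (Finset.univ.filter fun j => r j ≤ x j) ∧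
        ∀ j ∈ (Finset.univ.filter fun j => r j ≤ x j), x j ≤ x (we x)) :
    ∑ i, payE r i x ≤ revE r we x := by
  have hz : ∀ i, i ≠ we x → payE r i x = 0 := by
    intro i hi
    unfold payE
    rw [if_neg]
    intro hlt
    have hri : r i ≤ x i := (r_le_thE r i x).trans hlt.le
    obtain ⟨h1, h2⟩ := hwe ⟨i, by simpa using hri⟩
    have h3 := h2 i (by simpa using hri)
    have h4 := le_thE r i x (we x)
    have h1' : r (we x) ≤ x (we x) := by simpa using h1
    rw [if_neg (Ne.symm hi), if_pos h1'] at h4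
    linarith
  rw [Finset.sum_eq_single (we x) (fun i _ hi => hz i hi) (by simp)]
  unfold payE
  split_ifs with h
  · have hri : r (we x) ≤ x (we x) := (r_le_thE r _ x).trans h.le
    apply Finset.sup'_le
    intro j _
    have h1 := le_revE r we x j
    have h2 := revE_nonneg r hr we x
    by_cases hj : j = we x
    · rw [if_pos hj]
      rw [← hj] at hri ⊢
      rw [if_pos hri, if_pos hj] at h1
      exact h1
    · rw [if_neg hj]
      rw [if_neg hj] at h1
      exact h1
  · exact revE_nonneg r hr we x

theorem lazy_le (hr : ∀ i, 0 ≤ r i) (x : Fin n → ℝ) (w : Fin n) (hw : ∀ j, x j ≤ x w)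
    (hne : (Finset.univ.erase w).Nonempty) :
    (if r w ≤ x w then max (r w) ((Finset.univ.erase w).sup' hne x) else 0)
      ≤ ∑ i, payL r i x := by
  have hn := fun i (_ : i ∈ Finset.univ) => payL_nonneg r hr i x
  split_ifs with h
  · refine le_trans ?_ (Finset.single_le_sum hn (Finset.mem_univ w))
    have : thL r w x ≤ x w := by
      apply Finset.sup'_le
      intro j _
      have := hw j
      split_ifs <;> linarith
    unfold payL
    rw [if_pos this]
    apply max_le (r_le_thL r w x)
    apply Finset.sup'_le
    intro j hj
    have h1 := le_thL r w x j
    rwa [if_neg (Finset.ne_of_mem_erase hj)] at h1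
  · exact Finset.sum_nonneg hn

end

/-- **Eager beats lazy at monopoly reserve prices.**
Let `X₁,…,Xₙ` be independent with regular cdfs `Fᵢ` (virtual values `ψᵢ`) and let
`rᵢ = ψᵢ⁻¹(0)` be the monopoly prices.  A key step is that regularity implies that
`x ↦ x (1 - Fᵢ x)` is nonincreasing on `[rᵢ, ∞)`; and the expected revenue of the eager
second-price auction with reserves `(r₁,…,rₙ)` (winner `we x`, the highest bidder among
those clearing their reserve) is at least that of the lazy second-price auction with the
same reserves (winner `wl x`, the overall highest bidder, who wins iff he clears his
reserve). -/
theorem eager_revenue_ge_lazy_revenue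
    (n : ℕ) (hn : 2 ≤ n)
    (F f ψ : Fin n → ℝ → ℝ)
    (hf_cont : ∀ i, Continuous (f i))
    (hf_pos : ∀ i x, 0 ≤ x → 0 < f i x)
    (hF : ∀ i x, F i x = ∫ t in (0:ℝ)..x, f i t)
    (hψ : ∀ i x, ψ i x = x - (1 - F i x) / f i x)
    (hreg : ∀ i, StrictMonoOn (ψ i) (Ici 0))
    (μ : Fin n → Measure ℝ) (hμ : ∀ i, μ i = valueMeasure (f i))
    (hprob : ∀ i, IsProbabilityMeasure (μ i))
    (hexp : ∀ i, Integrable (fun x => x) (μ i))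
    (r : Fin n → ℝ) (hr_nonneg : ∀ i, 0 ≤ r i) (hr_root : ∀ i, ψ i (r i) = 0)
    (wl : (Fin n → ℝ) → Fin n)
    (hwl_meas : ∀ i, MeasurableSet {x : Fin n → ℝ | wl x = i})
    (hwl_max : ∀ (x : Fin n → ℝ) (j : Fin n), x j ≤ x (wl x))
    (we : (Fin n → ℝ) → Fin n)
    (hwe_meas : ∀ i, MeasurableSet {x : Fin n → ℝ | we x = i})
    (hwe_win : ∀ x : Fin n → ℝ, (Finset.univ.filter fun j => r j ≤ x j).Nonempty →
      we x ∈ (Finset.univ.filter fun j => r j ≤ x j) ∧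
        ∀ j ∈ (Finset.univ.filter fun j => r j ≤ x j), x j ≤ x (we x)) :
    (∀ i, AntitoneOn (fun x => x * (1 - F i x)) (Ici (r i))) ∧
      (∫ x : Fin n → ℝ,
          (if r (wl x) ≤ x (wl x) then
            max (r (wl x))
              ((Finset.univ.erase (wl x)).sup'
                (by
                  rw [← Finset.card_pos, Finset.card_erase_of_mem (Finset.mem_univ _),
                    Finset.card_univ, Fintype.card_fin]
                  omega)
                x)
          else 0)
          ∂Measure.pi μ)
        ≤ ∫ x : Fin n → ℝ,
            (if hS : (Finset.univ.filter fun j => r j ≤ x j).Nonempty then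
              (Finset.univ.filter fun j => r j ≤ x j).sup' hS
                fun j => if j = we x then r (we x) else x j
            else 0)
            ∂Measure.pi μ := by
  have hanti : ∀ i, AntitoneOn (fun x => x * (1 - F i x)) (Ici (r i)) := fun i =>
    key_antitone (F i) (f i) (ψ i) (hf_cont i) (hf_pos i) (hF i) (hψ i) (hreg i) (r i)
      (hr_nonneg i) (hr_root i)
  refine ⟨hanti, ?_⟩
  haveI : NeZero n := ⟨by omega⟩
  have hpay := integral_pay r hr_nonneg F f hf_cont hf_pos hF hanti μ hμ hprob hexp
  simp only [revE_eq r hr_nonneg we]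
  have iE : Integrable (revE r we) (Measure.pi μ) := by
    refine (integrable_bound r μ hprob hexp).mono'
      (measurable_revE r we hwe_meas).aestronglyMeasurable (Filter.Eventually.of_forall ?_)
    intro x
    rw [Real.norm_of_nonneg (revE_nonneg r hr_nonneg we x)]
    exact revE_le r hr_nonneg we x
  calc _ ≤ ∫ x, ∑ i, payL r i x ∂Measure.pi μ := by
        refine integral_mono_of_nonneg (Filter.Eventually.of_forall ?_)
          (integrable_finsetSum _ fun i _ => (hpay i).1) (Filter.Eventually.of_forall ?_)
        · intro x
          have := hr_nonneg (wl x)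
          dsimp only [Pi.zero_apply]
          split_ifs
          · exact this.trans (le_max_left _ _)
          · exact le_rfl
        · intro x
          exact lazy_le r hr_nonneg x (wl x) (hwl_max x) _
    _ = ∑ i, ∫ x, payL r i x ∂Measure.pi μ := integral_finsetSum _ fun i _ => (hpay i).1
    _ ≤ ∑ i, ∫ x, payE r i x ∂Measure.pi μ := Finset.sum_le_sum fun i _ => (hpay i).2.2
    _ = ∫ x, ∑ i, payE r i x ∂Measure.pi μ := (integral_finsetSum _ fun i _ => (hpay i).2.1).symm
    _ ≤ _ := integral_mono (integrable_finsetSum _ fun i _ => (hpay i).2.1) iE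
        fun x => sum_payE_le r hr_nonneg we x (hwe_win x)
end

section
/- (Impossibility of distribution-free learning of near-optimal prices) For every sample size T ∈ ℕ, every pricing algorithm A: ℝ^T → ℝ, every ε ∈ (0,1) and every δ ∈ (0,1), there exists z > 1 such that, for the two-point value distribution F_z that equals z² with probability 1/z and 0 with probability 1 − 1/z: the optimal posted-price revenue is z (attained by posting z²), yet if S ∼ F_z^T is an i.i.d. sample, then with probability at least 1 − δ the revenue of the price returned by the algorithm satisfies A(S) · ℙ_{X ∼ F_z}(X ≥ A(S)) ≤ ε · z. In particular, no algorithm with a fixed sample size can guarantee an ε-fraction of the optimal posted-price revenue over all value distributions with any constant probability. -/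
open MeasureTheory Set

/-- The two-point value distribution `F_z`: value `z²` with probability `1/z` and
value `0` with probability `1 - 1/z`. -/
noncomputable def twoPoint (z : ℝ) : Measure ℝ :=
  ENNReal.ofReal (1 / z) • Measure.dirac (z ^ 2) +
    ENNReal.ofReal (1 - 1 / z) • Measure.dirac 0

theorem twoPoint_Ici_toReal (z : ℝ) (hz : 1 < z) (p : ℝ) :
    ((twoPoint z) (Ici p)).toReal =
      (1 / z) * (if p ≤ z ^ 2 then 1 else 0) + (1 - 1 / z) * (if p ≤ 0 then 1 else 0) := by
  have h1 : 0 ≤ 1 / z := by positivity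
  have h2 : 0 ≤ 1 - 1 / z := by
    have : 1 / z ≤ 1 := by rw [div_le_one (by linarith)]; linarith
    linarith
  unfold twoPoint
  rw [Measure.add_apply, Measure.smul_apply, Measure.smul_apply,
    Measure.dirac_apply' _ measurableSet_Ici, Measure.dirac_apply' _ measurableSet_Ici]
  simp only [Set.indicator_apply, mem_Ici, Pi.one_apply, smul_eq_mul]
  split_ifs <;> simp only [mul_one, mul_zero, add_zero, zero_add, ENNReal.toReal_zero] <;>
    first
    | rw [← ENNReal.ofReal_add h1 h2, ENNReal.toReal_ofReal (add_nonneg h1 h2)]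
    | rw [ENNReal.toReal_ofReal h1]
    | rw [ENNReal.toReal_ofReal h2]

instance twoPoint_finite (z : ℝ) : IsFiniteMeasure (twoPoint z) := by
  constructor
  unfold twoPoint
  simp

/-- **Impossibility of distribution-free learning of near-optimal prices.**
For every sample size `T`, every pricing algorithm `A : ℝᵀ → ℝ` and every
`ε, δ ∈ (0,1)`, there is `z > 1` such that for the two-point distribution `F_z`:
the optimal posted-price revenue is `z` (attained by posting `z²`), yet with probability
at least `1 - δ` over an i.i.d. sample `S ∼ F_z^T`, the revenue of the price returned by
the algorithm is at most `ε·z`.  Hence no fixed-sample-size algorithm guarantees an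
`ε`-fraction of the optimal posted-price revenue over all value distributions with any
constant probability. -/
theorem no_distribution_free_pricing
    (T : ℕ) (A : (Fin T → ℝ) → ℝ) (ε δ : ℝ)
    (hε : ε ∈ Ioo (0:ℝ) 1) (hδ : δ ∈ Ioo (0:ℝ) 1) :
    ∃ z : ℝ, 1 < z ∧
      z ^ 2 * ((twoPoint z) (Ici (z ^ 2))).toReal = z ∧
      (∀ p : ℝ, p * ((twoPoint z) (Ici p)).toReal ≤ z) ∧
      ENNReal.ofReal (1 - δ) ≤
        (Measure.pi fun _ : Fin T => twoPoint z)
          {s | A s * ((twoPoint z) (Ici (A s))).toReal ≤ ε * z} := by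
  obtain ⟨hε0, hε1⟩ := hε
  obtain ⟨hδ0, hδ1⟩ := hδ
  set q : ℝ := A (fun _ => 0) with hq
  set z : ℝ := 2 + T / δ + |q| / ε with hzdef
  have ha : 0 ≤ (T : ℝ) / δ := by positivity
  have hb : 0 ≤ |q| / ε := by positivity
  have hz : 1 < z := by linarith
  have hz0 : 0 < z := by linarith
  have h1 : 0 ≤ 1 / z := by positivity
  have h2 : 1 / z ≤ 1 := by rw [div_le_one hz0]; linarith
  have hTz : (T : ℝ) * (1 / z) ≤ δ := by
    have : (T : ℝ) / δ ≤ z := by linarith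
    rw [div_le_iff₀ hδ0] at this
    rw [mul_one_div, div_le_iff₀ hz0]; linarith
  have hqz : |q| ≤ ε * z := by
    have : |q| / ε ≤ z := by linarith
    rw [div_le_iff₀ hε0] at this
    linarith
  have hzz : z ^ 2 * (1 / z) = z := by field_simp
  refine ⟨z, hz, ?_, ?_, ?_⟩
  · rw [twoPoint_Ici_toReal z hz, if_pos le_rfl, if_neg (by have := pow_pos hz0 2; linarith)]
    rw [mul_one, mul_zero, add_zero, hzz]
  · intro p
    rw [twoPoint_Ici_toReal z hz]
    by_cases hp0 : p ≤ 0
    · rw [if_pos hp0, if_pos (hp0.trans (by positivity))]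
      linarith
    · rw [if_neg hp0]
      split_ifs with hp
      · have := mul_le_mul_of_nonneg_right hp h1
        linarith
      · simp only [mul_zero, add_zero]; linarith
  · have hsub : Set.pi univ (fun _ : Fin T => ({0} : Set ℝ)) ⊆
        {s | A s * ((twoPoint z) (Ici (A s))).toReal ≤ ε * z} := by
      intro s hs
      have hs0 : s = fun _ => 0 := by
        funext i
        exact hs i (mem_univ i)
      subst hs0
      change q * ((twoPoint z) (Ici q)).toReal ≤ ε * z
      rw [twoPoint_Ici_toReal z hz]
      have hqa := le_abs_self q
      have hqn := abs_nonneg q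
      by_cases hp0 : q ≤ 0
      · rw [if_pos hp0, if_pos (hp0.trans (by positivity))]
        linarith
      · rw [if_neg hp0]
        split_ifs with hp
        · have := mul_le_mul_of_nonneg_left h2 (not_le.mp hp0).le
          linarith
        · simp only [mul_zero, add_zero]; linarith
    refine le_trans ?_ (measure_mono hsub)
    rw [Measure.pi_pi]
    have h0 : ENNReal.ofReal (1 - 1 / z) ≤ twoPoint z {0} := by
      unfold twoPoint
      rw [Measure.add_apply, Measure.smul_apply, Measure.smul_apply]
      simp
    rw [Finset.prod_const, Finset.card_univ, Fintype.card_fin]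
    refine le_trans ?_ (pow_le_pow_left' h0 T)
    rw [← ENNReal.ofReal_pow (by linarith)]
    apply ENNReal.ofReal_le_ofReal
    have hB := one_add_mul_le_pow (a := -(1 / z)) (by linarith) T
    rw [← sub_eq_add_neg] at hB
    linarith
end

section
/- There exists a regular value distribution F and constants η₀ > 0 and δ₀ > 0 such that, for every sample size T, with probability greater than δ₀ over an i.i.d. sample S_T = (x₁, …, x_T) ∼ F^T, every empirical monopoly price r̂ — i.e., every maximizer of the empirical revenue r ↦ r · #{t : x_t ≥ r}/T — satisfies Π(r̂) < (1 − η₀) · sup_r Π(r), where Π(r) = r(1 − F(r)) is the true monopoly revenue. A witnessing distribution is F(x) = 1 − 1/x for 1 ≤ x ≤ 2 and F(x) = 1 − 1/(2(x − 1)) for x > 2, which is regular (its virtual value equals 0 on (1,2) and 1 beyond 2) with sup_r Π(r) = 1, while with constant probability a sample contains a value ≥ 4T forcing r̂ ≥ 4 and hence Π(r̂) ≤ 2/3. -/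
open MeasureTheory Set

/-- Empirical revenue of a posted price `r` on a sample `s` of `T` values:
`r · #{t : sₜ ≥ r} / T`. -/
noncomputable def empRev (T : ℕ) (s : Fin T → ℝ) (r : ℝ) : ℝ :=
  r * ((Finset.univ.filter fun t => r ≤ s t).card : ℝ) / T

noncomputable def auxG (x : ℝ) : ℝ := max 1 (max x (2 * (x - 1)))

lemma auxG_one_le (x : ℝ) : 1 ≤ auxG x := le_max_left _ _
lemma auxG_self_le (x : ℝ) : x ≤ auxG x := (le_max_left _ _).trans (le_max_right _ _)
lemma auxG_pos (x : ℝ) : 0 < auxG x := lt_of_lt_of_le one_pos (auxG_one_le x)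
lemma auxG_cont : Continuous auxG := by unfold auxG; fun_prop
lemma auxG_mono : Monotone auxG := by
  intro a b h
  unfold auxG
  gcongr
lemma auxG_low {x : ℝ} (h : x ≤ 1) : auxG x = 1 := by
  unfold auxG
  rw [max_eq_left]
  exact max_le h (by linarith)
lemma auxG_mid {x : ℝ} (h : 1 ≤ x) (h2 : x ≤ 2) : auxG x = x := by
  unfold auxG
  rw [max_eq_left (by linarith : 2 * (x - 1) ≤ x), max_eq_right h]
lemma auxG_high {x : ℝ} (h2 : 2 ≤ x) : auxG x = 2 * (x - 1) := by
  unfold auxG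
  rw [max_eq_right (by linarith : x ≤ 2 * (x - 1)), max_eq_right (by linarith)]

noncomputable def auxF : StieltjesFunction ℝ where
  toFun x := 1 - 1 / auxG x
  mono' := by
    intro a b h
    have := one_div_le_one_div_of_le (auxG_pos a) (auxG_mono h)
    show 1 - 1 / auxG a ≤ 1 - 1 / auxG b
    linarith
  right_continuous' x := by
    have : Continuous fun x => 1 - 1 / auxG x :=
      continuous_const.sub (continuous_const.div auxG_cont fun x => (auxG_pos x).ne')
    exact this.continuousWithinAt

lemma auxF_apply (x : ℝ) : auxF x = 1 - 1 / auxG x := rfl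

lemma auxF_bot : Filter.Tendsto auxF Filter.atBot (nhds 0) := by
  refine tendsto_const_nhds.congr' ?_
  filter_upwards [Filter.eventually_le_atBot (1:ℝ)] with x hx
  rw [auxF_apply, auxG_low hx]; norm_num

lemma auxF_top : Filter.Tendsto auxF Filter.atTop (nhds 1) := by
  have h : Filter.Tendsto auxG Filter.atTop Filter.atTop :=
    Filter.tendsto_atTop_mono auxG_self_le Filter.tendsto_id
  have := (tendsto_const_nhds (x := (1:ℝ))).sub h.inv_tendsto_atTop
  simp only [sub_zero] at this
  refine this.congr fun x => ?_
  simp [auxF_apply]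

lemma auxF_nonneg (x : ℝ) : 0 ≤ auxF x := by
  rw [auxF_apply]
  have := one_div_le_one_div_of_le one_pos (auxG_one_le x)
  linarith

lemma aux_sSup : sSup (Set.range fun r => r * (1 - auxF r)) = 1 := by
  apply IsGreatest.csSup_eq
  constructor
  · exact ⟨1, by simp [auxF_apply, auxG_low le_rfl]⟩
  · rintro _ ⟨r, rfl⟩
    simp only [auxF_apply, sub_sub_cancel, mul_one_div]
    exact (div_le_one (auxG_pos r)).2 (auxG_self_le r)

lemma aux_rhat (T : ℕ) (hT : 1 ≤ T) (s : Fin T → ℝ) (t : Fin T) (ht : 4 * (T:ℝ) < s t)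
    (rhat : ℝ) (h : ∀ r : ℝ, empRev T s r ≤ empRev T s rhat) :
    rhat * (1 - auxF rhat) < 3 / 4 := by
  have hT0 : (0:ℝ) < T := by exact_mod_cast hT
  have h1 := h (s t)
  have hc : (1:ℝ) ≤ ((Finset.univ.filter fun u => s t ≤ s u).card : ℝ) := by
    exact_mod_cast Finset.card_pos.2 ⟨t, by simp⟩
  have hc2 : ((Finset.univ.filter fun u => rhat ≤ s u).card : ℝ) ≤ T := by
    have := Finset.card_filter_le (Finset.univ : Finset (Fin T)) (fun u => rhat ≤ s u)
    rw [Finset.card_univ, Fintype.card_fin] at this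
    exact_mod_cast this
  have hc3 : (0:ℝ) ≤ ((Finset.univ.filter fun u => rhat ≤ s u).card : ℝ) := by positivity
  unfold empRev at h1
  rw [div_le_div_iff_of_pos_right hT0] at h1
  have hr : 4 ≤ rhat := by
    by_contra hlt
    push Not at hlt
    nlinarith
  rw [auxF_apply, auxG_high (by linarith), sub_sub_cancel, mul_one_div,
    div_lt_iff₀ (by linarith)]
  linarith

instance auxF_prob : IsProbabilityMeasure auxF.measure :=
  auxF.isProbabilityMeasure auxF_bot auxF_top

lemma auxF_Iic (x : ℝ) : auxF.measure (Iic x) = ENNReal.ofReal (auxF x) := by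
  rw [auxF.measure_Iic auxF_bot, sub_zero]

lemma aux_pow (T : ℕ) (hT : 1 ≤ T) : (auxF (4 * T)) ^ T ≤ 8 / 9 := by
  have hT0 : (1:ℝ) ≤ T := by exact_mod_cast hT
  have hle : auxF (4 * T) ≤ (1 + 1 / (8 * (T:ℝ)))⁻¹ := by
    rw [auxF_apply, auxG_high (by linarith)]
    have h1 : 1 / (8 * (T:ℝ)) ≤ 1 / (2 * (4 * T - 1)) :=
      one_div_le_one_div_of_le (by linarith) (by linarith)
    have hp : 0 < 1 / (8 * (T:ℝ)) := by positivity
    rw [← one_div, le_div_iff₀ (by linarith)]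
    nlinarith
  have hb := one_add_mul_le_pow (a := 1 / (8 * (T:ℝ)))
    (by have : 0 < 1 / (8 * (T:ℝ)) := by positivity
        linarith) T
  have he : 1 + (T:ℝ) * (1 / (8 * (T:ℝ))) = 9 / 8 := by field_simp; norm_num
  rw [he] at hb
  calc (auxF (4 * T)) ^ T ≤ ((1 + 1 / (8 * (T:ℝ)))⁻¹) ^ T :=
        pow_le_pow_left₀ (auxF_nonneg _) hle _
    _ = ((1 + 1 / (8 * (T:ℝ))) ^ T)⁻¹ := inv_pow _ _
    _ ≤ (9 / 8 : ℝ)⁻¹ := inv_anti₀ (by norm_num) hb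
    _ = 8 / 9 := by norm_num

lemma aux_prob (T : ℕ) (hT : 1 ≤ T) : ENNReal.ofReal (1 / 16) <
    (Measure.pi fun _ : Fin T => auxF.measure) {s | ∃ t, 4 * (T:ℝ) < s t} := by
  have hset : {s : Fin T → ℝ | ∃ t, 4 * (T:ℝ) < s t} =
      (Set.univ.pi fun _ : Fin T => Iic (4 * (T:ℝ)))ᶜ := by
    ext s; simp [Pi.le_def]
  rw [hset, prob_compl_eq_one_sub (MeasurableSet.univ_pi fun _ => measurableSet_Iic),
    Measure.pi_pi]
  simp only [auxF_Iic, Finset.prod_const, Finset.card_univ, Fintype.card_fin]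
  rw [← ENNReal.ofReal_pow (auxF_nonneg _), ← ENNReal.ofReal_one,
    ← ENNReal.ofReal_sub _ (pow_nonneg (auxF_nonneg _) _)]
  have := aux_pow T hT
  exact (ENNReal.ofReal_lt_ofReal_iff (by linarith)).2 (by linarith)

/-- **Empirical revenue maximization fails on a heavy-tailed regular distribution.**
There exist a regular value distribution (cdf `F`, equal to `1 - 1/x` on `[1,2]` and
`1 - 1/(2(x-1))` beyond `2`, with density `fdens` whose virtual value is `0` on `(1,2)`
and `1` on `(2,∞)`, hence weakly increasing) and constants `η₀, δ₀ > 0` such that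
`sup_r Π(r) = 1` where `Π(r) = r (1 - F r)`, and for every sample size `T ≥ 1`, with
probability greater than `δ₀` over an i.i.d. sample of size `T`, every empirical monopoly
price `r̂` (maximizer of the empirical revenue) satisfies
`Π(r̂) < (1 - η₀) · sup_r Π(r)`. -/
theorem empirical_monopoly_price_fails :
    ∃ (F fdens : ℝ → ℝ) (μ : Measure ℝ) (η₀ δ₀ : ℝ),
      IsProbabilityMeasure μ ∧
      (∀ x, F x = (μ (Iic x)).toReal) ∧
      (∀ x, x ≤ 1 → F x = 0) ∧
      (∀ x, 1 ≤ x → x ≤ 2 → F x = 1 - 1 / x) ∧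
      (∀ x, 2 ≤ x → F x = 1 - 1 / (2 * (x - 1))) ∧
      (∀ x ∈ Ioo (1:ℝ) 2, HasDerivAt F (fdens x) x) ∧
      (∀ x ∈ Ioi (2:ℝ), HasDerivAt F (fdens x) x) ∧
      (∀ x ∈ Ioo (1:ℝ) 2, x - (1 - F x) / fdens x = 0) ∧
      (∀ x ∈ Ioi (2:ℝ), x - (1 - F x) / fdens x = 1) ∧
      0 < η₀ ∧ 0 < δ₀ ∧
      sSup (Set.range fun r => r * (1 - F r)) = 1 ∧
      (∀ T : ℕ, 1 ≤ T →
        ENNReal.ofReal δ₀ <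
          (Measure.pi fun _ : Fin T => μ)
            {s | ∀ rhat : ℝ, (∀ r : ℝ, empRev T s r ≤ empRev T s rhat) →
              rhat * (1 - F rhat) < (1 - η₀) * sSup (Set.range fun r => r * (1 - F r))}) := by
  refine ⟨auxF, fun x => if x < 2 then 1 / x ^ 2 else 1 / (2 * (x - 1) ^ 2), auxF.measure,
    1 / 4, 1 / 16, auxF_prob, ?_, ?_, ?_, ?_, ?_, ?_, ?_, ?_, by norm_num, by norm_num,
    aux_sSup, ?_⟩
  · intro x
    rw [auxF_Iic, ENNReal.toReal_ofReal (auxF_nonneg x)]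
  · intro x hx
    rw [auxF_apply, auxG_low hx]; norm_num
  · intro x h1 h2
    rw [auxF_apply, auxG_mid h1 h2]
  · intro x h2
    rw [auxF_apply, auxG_high h2]
  · rintro x ⟨h1, h2⟩
    have hx : x ≠ 0 := by linarith
    have hd : HasDerivAt (fun y : ℝ => 1 - y⁻¹) (1 / x ^ 2) x := by
      refine ((hasDerivAt_inv hx).const_sub 1).congr_deriv ?_
      ring
    simp only [h2, if_true]
    refine hd.congr_of_eventuallyEq ?_
    filter_upwards [Ioo_mem_nhds h1 h2] with y hy
    rw [auxF_apply, auxG_mid hy.1.le hy.2.le, one_div]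
  · intro x h2
    have h2' : (2:ℝ) < x := h2
    have hx : 2 * (x - 1) ≠ 0 := by linarith
    have hx1 : x - 1 ≠ 0 := by linarith
    have hl : HasDerivAt (fun y : ℝ => 2 * (y - 1)) 2 x := by
      simpa using ((hasDerivAt_id x).sub_const 1).const_mul 2
    have hd : HasDerivAt (fun y : ℝ => 1 - (2 * (y - 1))⁻¹) (1 / (2 * (x - 1) ^ 2)) x := by
      refine ((hl.fun_inv hx).const_sub 1).congr_deriv ?_
      field_simp
      try norm_num
    simp only [not_lt.2 h2'.le, if_false]
    refine hd.congr_of_eventuallyEq ?_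
    filter_upwards [Ioi_mem_nhds h2'] with y hy
    rw [auxF_apply, auxG_high (le_of_lt hy), one_div]
  · rintro x ⟨h1, h2⟩
    have hx : x ≠ 0 := by linarith
    simp only [h2, if_true]
    rw [auxF_apply, auxG_mid h1.le h2.le]
    field_simp
    try ring
  · intro x h2
    have h2' : (2:ℝ) < x := h2
    have hx1 : x - 1 ≠ 0 := by linarith
    simp only [not_lt.2 h2'.le, if_false]
    rw [auxF_apply, auxG_high h2'.le]
    field_simp
    try ring
  · intro T hT
    refine (aux_prob T hT).trans_le (measure_mono ?_)
    rintro s ⟨t, ht⟩ rhat h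
    rw [aux_sSup]
    have := aux_rhat T hT s t ht rhat h
    linarith
end
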